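/- Let ℓ ≥ 3 be an integer, μ ∈ ℝ^ℓ, τ > 0, and let M be a random vector in ℝ^ℓ with independent coordinates M_i ~ N(μ_i, τ²). With κ = ‖μ‖²/(2τ²), it holds that E[(M − μ)'M/‖M‖²] = ∑_{k=0}^∞ ((ℓ−2)/(ℓ−2+2k))·κ^k e^{−κ}/k!. -/

import Mathlib

open MeasureTheory ProbabilityTheory

/-- The law of a random vector `M` in `ℝ^ℓ` with independent coordinates
`M_i ~ N(μ_i, τ²)`: the product of the real Gaussian measures. -/
noncomputable def gaussianVecLaw (ℓ : ℕ) (μ : Fin ℓ → ℝ) (τ : ℝ) :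
    Measure (Fin ℓ → ℝ) :=
  Measure.pi fun i => gaussianReal (μ i) (τ ^ 2).toNNReal

theorem one_add_two_mul_mul_pos {v s : ℝ} (hv : 0 < v) (hs : 0 ≤ s) : 0 < 1 + 2 * s * v := by
  positivity

theorem hasDerivAt_one_add_rpow {v : ℝ} (hv : 0 < v) (r : ℝ) {s : ℝ} (hs : 0 ≤ s) :
    HasDerivAt (fun s : ℝ => (1 + 2 * s * v) ^ r) (2 * v * r * (1 + 2 * s * v) ^ (r - 1)) s := by
  have h : HasDerivAt (fun s : ℝ => 1 + 2 * s * v) (2 * v) s := by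
    simpa using (((hasDerivAt_id s).const_mul 2).mul_const v).const_add 1
  exact h.rpow_const (Or.inl (one_add_two_mul_mul_pos hv hs).ne')

theorem tendsto_one_add_rpow_neg {v : ℝ} (hv : 0 < v) {r : ℝ} (hr : 0 < r) :
    Filter.Tendsto (fun s : ℝ => (1 + 2 * s * v) ^ (-r)) Filter.atTop (nhds 0) := by
  refine (tendsto_rpow_neg_atTop hr).comp (Filter.tendsto_atTop_add_const_left _ _ ?_)
  exact (Filter.tendsto_id.const_mul_atTop two_pos).atTop_mul_const hv

theorem hasDerivAt_rpow_primitive {v : ℝ} (hv : 0 < v) {r : ℝ} (hr : 1 < r) {s : ℝ} (hs : 0 ≤ s) :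
    HasDerivAt (fun s : ℝ => -(2 * v * (r - 1))⁻¹ * (1 + 2 * s * v) ^ (-(r - 1)))
      ((1 + 2 * s * v) ^ (-r)) s := by
  refine ((hasDerivAt_one_add_rpow hv (-(r - 1)) hs).const_mul
    (-(2 * v * (r - 1))⁻¹)).congr_deriv ?_
  have : r - 1 ≠ 0 := by linarith
  rw [show -(r - 1) - 1 = -r by ring]
  field_simp

theorem tendsto_rpow_primitive {v : ℝ} (hv : 0 < v) {r : ℝ} (hr : 1 < r) :
    Filter.Tendsto (fun s : ℝ => -(2 * v * (r - 1))⁻¹ * (1 + 2 * s * v) ^ (-(r - 1)))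
      Filter.atTop (nhds 0) := by
  simpa using (tendsto_one_add_rpow_neg hv (sub_pos.2 hr)).const_mul (-(2 * v * (r - 1))⁻¹)

theorem integrableOn_one_add_rpow_neg {v : ℝ} (hv : 0 < v) {r : ℝ} (hr : 1 < r) :
    IntegrableOn (fun s : ℝ => (1 + 2 * s * v) ^ (-r)) (Set.Ioi 0) :=
  integrableOn_Ioi_deriv_of_nonneg' (fun _ hs => hasDerivAt_rpow_primitive hv hr hs)
    (fun _ hs => Real.rpow_nonneg (one_add_two_mul_mul_pos hv (le_of_lt hs)).le _)
    (tendsto_rpow_primitive hv hr)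

theorem integral_one_add_rpow_neg {v : ℝ} (hv : 0 < v) {r : ℝ} (hr : 1 < r) :
    ∫ s in Set.Ioi (0 : ℝ), (1 + 2 * s * v) ^ (-r) = (2 * v * (r - 1))⁻¹ := by
  rw [integral_Ioi_of_hasDerivAt_of_tendsto' (fun _ hs => hasDerivAt_rpow_primitive hv hr hs)
    (integrableOn_one_add_rpow_neg hv hr) (tendsto_rpow_primitive hv hr)]
  simp

/-- The Laplace transform at `s` of the squared norm of a Gaussian vector in dimension `2 * p` with
mean of squared norm `S` and variance `v` in each direction. -/
noncomputable def noncentralLaplace (p v S s : ℝ) : ℝ :=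
  (1 + 2 * s * v) ^ (-p) * Real.exp (-(s * S / (1 + 2 * s * v)))

theorem measurable_noncentralLaplace (p v S : ℝ) : Measurable (noncentralLaplace p v S) := by
  unfold noncentralLaplace
  fun_prop

theorem noncentralLaplace_nonneg {p v S s : ℝ} (hv : 0 < v) (hs : 0 ≤ s) :
    0 ≤ noncentralLaplace p v S s :=
  mul_nonneg (Real.rpow_nonneg (one_add_two_mul_mul_pos hv hs).le _) (Real.exp_pos _).le

theorem noncentralLaplace_le {p v S s : ℝ} (hv : 0 < v) (hS : 0 ≤ S) (hs : 0 ≤ s) :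
    noncentralLaplace p v S s ≤ (1 + 2 * s * v) ^ (-p) := by
  refine mul_le_of_le_one_right (Real.rpow_nonneg (one_add_two_mul_mul_pos hv hs).le _) ?_
  rw [Real.exp_le_one_iff, neg_nonpos]
  positivity

theorem integrableOn_noncentralLaplace {p v S : ℝ} (hp : 1 < p) (hv : 0 < v) (hS : 0 ≤ S) :
    IntegrableOn (noncentralLaplace p v S) (Set.Ioi 0) := by
  refine (integrableOn_one_add_rpow_neg hv hp).mono'
    (measurable_noncentralLaplace p v S).aestronglyMeasurable ?_
  filter_upwards [ae_restrict_mem measurableSet_Ioi] with s hs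
  rw [Real.norm_of_nonneg (noncentralLaplace_nonneg hv (le_of_lt hs))]
  exact noncentralLaplace_le hv hS (le_of_lt hs)

theorem integrableOn_div_mul_noncentralLaplace {p v S : ℝ} (hp : 1 < p) (hv : 0 < v) (hS : 0 ≤ S)
    (b : ℝ) :
    IntegrableOn (fun s => b / (1 + 2 * s * v) * noncentralLaplace p v S s) (Set.Ioi 0) := by
  refine ((integrableOn_noncentralLaplace hp hv hS).const_mul |b|).mono'
    (by have := measurable_noncentralLaplace p v S; fun_prop) ?_
  filter_upwards [ae_restrict_mem measurableSet_Ioi] with s hs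
  have hs : 0 < s := hs
  rw [norm_mul, Real.norm_of_nonneg (noncentralLaplace_nonneg hv hs.le), norm_div,
    Real.norm_eq_abs, Real.norm_of_nonneg (one_add_two_mul_mul_pos hv hs.le).le]
  have : 1 ≤ 1 + 2 * s * v := le_add_of_nonneg_right (by positivity)
  exact mul_le_mul_of_nonneg_right (div_le_self (abs_nonneg b) this)
    (noncentralLaplace_nonneg hv hs.le)

theorem integral_div_mul_noncentralLaplace {p v S : ℝ} (hp : 1 < p) (hv : 0 < v) (hS : 0 ≤ S) :
    ∫ s in Set.Ioi (0 : ℝ), S / (1 + 2 * s * v) * noncentralLaplace p v S s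
      = 1 - 2 * v * (p - 1) * ∫ s in Set.Ioi (0 : ℝ), noncentralLaplace p v S s := by
  have hderiv : ∀ s ∈ Set.Ici (0 : ℝ), HasDerivAt (noncentralLaplace (p - 1) v S)
      (-(2 * v * (p - 1)) * noncentralLaplace p v S s
        - S / (1 + 2 * s * v) * noncentralLaplace p v S s) s := by
    intro s hs
    have ha := one_add_two_mul_mul_pos hv hs
    have h1 : HasDerivAt (fun s : ℝ => 1 + 2 * s * v) (2 * v) s := by
      simpa using (((hasDerivAt_id s).const_mul 2).mul_const v).const_add 1
    have h2 := ((((hasDerivAt_id s).mul_const S).div h1 ha.ne').neg).exp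
    have h3 := (hasDerivAt_one_add_rpow hv (-(p - 1)) hs).mul h2
    refine h3.congr_deriv ?_
    simp only [noncentralLaplace, id, Pi.neg_apply, Pi.div_apply]
    rw [show -(p - 1) - 1 = -p by ring, show -(p - 1) = -p + 1 by ring, Real.rpow_add_one ha.ne']
    field_simp
    ring
  have hlim : Filter.Tendsto (noncentralLaplace (p - 1) v S) Filter.atTop (nhds 0) := by
    refine squeeze_zero' ?_ ?_ (tendsto_one_add_rpow_neg hv (sub_pos.2 hp))
    · filter_upwards [Filter.eventually_ge_atTop 0] with s hs using noncentralLaplace_nonneg hv hs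
    · filter_upwards [Filter.eventually_ge_atTop 0] with s hs using noncentralLaplace_le hv hS hs
  have hA := (integrableOn_noncentralLaplace hp hv hS).const_mul (-(2 * v * (p - 1)))
  have hB := integrableOn_div_mul_noncentralLaplace hp hv hS S
  have h := integral_Ioi_of_hasDerivAt_of_tendsto' hderiv (hA.sub hB) hlim
  rw [integral_sub hA hB, integral_const_mul] at h
  have h0 : noncentralLaplace (p - 1) v S 0 = 1 := by simp [noncentralLaplace]
  rw [h0] at h
  linarith

theorem integral_noncentralLaplace_eq_tsum {p v S : ℝ} (hp : 1 < p) (hv : 0 < v) (hS : 0 ≤ S) :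
    ∫ s in Set.Ioi (0 : ℝ), noncentralLaplace p v S s
      = ∑' k : ℕ, (2 * v * (p + k - 1))⁻¹
          * ((S / (2 * v)) ^ k * Real.exp (-(S / (2 * v))) / k.factorial) := by
  obtain ⟨κ, hκ⟩ : ∃ κ, κ = S / (2 * v) := ⟨_, rfl⟩
  have hκ0 : 0 ≤ κ := hκ ▸ by positivity
  rw [← hκ]
  set c : ℕ → ℝ := fun k => κ ^ k * Real.exp (-κ) / k.factorial with hc
  have hc0 : ∀ k, 0 ≤ c k := fun k => by positivity
  have hcs : Summable c := by
    simpa [hc, mul_div_right_comm] using (Real.summable_pow_div_factorial κ).mul_right (Real.exp (-κ))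
  have hpk : ∀ k : ℕ, 1 < p + k := fun k => by have := k.cast_nonneg (α := ℝ); linarith
  let F : ℕ → ℝ → ℝ := fun k s => (1 + 2 * s * v) ^ (-(p + k)) * c k
  have hF : ∀ k, ∫ s in Set.Ioi (0 : ℝ), F k s = (2 * v * (p + k - 1))⁻¹ * c k := fun k => by
    rw [integral_mul_const, integral_one_add_rpow_neg hv (hpk k)]
  have hFn : ∀ k, ∫ s in Set.Ioi (0 : ℝ), ‖F k s‖ = (2 * v * (p + k - 1))⁻¹ * c k := fun k => by
    rw [← hF k]
    refine setIntegral_congr_fun measurableSet_Ioi fun s hs => Real.norm_of_nonneg ?_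
    exact mul_nonneg (Real.rpow_nonneg (one_add_two_mul_mul_pos hv (le_of_lt hs)).le _) (hc0 k)
  have hsum : Summable fun k => ∫ s in Set.Ioi (0 : ℝ), ‖F k s‖ := by
    simp_rw [hFn]
    have hp1 : 0 < p - 1 := sub_pos.2 hp
    refine Summable.of_nonneg_of_le (fun k => ?_) (fun k => ?_) (hcs.mul_left (2 * v * (p - 1))⁻¹)
    · have := hpk k
      exact mul_nonneg (inv_nonneg.2 (mul_nonneg (by positivity) (by linarith))) (hc0 k)
    · refine mul_le_mul_of_nonneg_right ?_ (hc0 k)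
      gcongr
      simp
  have h := hasSum_integral_of_summable_integral_norm
    (fun k => (integrableOn_one_add_rpow_neg hv (hpk k)).mul_const (c k)) hsum
  refine Eq.trans ?_ (tsum_congr hF)
  rw [h.tsum_eq]
  refine setIntegral_congr_fun measurableSet_Ioi fun s hs => ?_
  have ha := one_add_two_mul_mul_pos hv (le_of_lt hs)
  have hexp : HasSum (fun k : ℕ => (κ / (1 + 2 * s * v)) ^ k / k.factorial)
      (Real.exp (κ / (1 + 2 * s * v))) := by
    rw [Real.exp_eq_exp_ℝ]
    exact NormedSpace.expSeries_div_hasSum_exp _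
  have h2 := hexp.mul_left ((1 + 2 * s * v) ^ (-p) * Real.exp (-κ))
  have hterm : (fun k => F k s) = fun k : ℕ => (1 + 2 * s * v) ^ (-p) * Real.exp (-κ)
      * ((κ / (1 + 2 * s * v)) ^ k / k.factorial) := by
    funext k
    simp only [F, hc]
    rw [neg_add, Real.rpow_add ha, Real.rpow_neg ha.le k, Real.rpow_natCast, div_pow]
    ring
  change noncentralLaplace p v S s = ∑' k, F k s
  rw [hterm, h2.tsum_eq, mul_assoc, ← Real.exp_add, noncentralLaplace]
  congr 2
  have hsS : s * S = κ * (1 + 2 * s * v) - κ := by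
    rw [hκ]
    field_simp
    ring
  rw [hsS, sub_div, mul_div_cancel_right₀ _ ha.ne']
  ring

theorem gaussianPDFReal_mul_exp_neg_mul_sq (m : ℝ) {v : NNReal} (hv : v ≠ 0) (s : NNReal) (x : ℝ) :
    gaussianPDFReal m v x * Real.exp (-(s * x ^ 2))
      = ((√(1 + 2 * s * v))⁻¹ * Real.exp (-(s * m ^ 2 / (1 + 2 * s * v))))
        * gaussianPDFReal (m / (1 + 2 * s * v)) (v / (1 + 2 * s * v)) x := by
  have hv' : (0 : ℝ) < v := by exact_mod_cast pos_iff_ne_zero.2 hv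
  have ha : (0 : ℝ) < 1 + 2 * s * v := one_add_two_mul_mul_pos hv' s.2
  simp only [gaussianPDFReal]
  push_cast
  have h1 : √(2 * Real.pi * (v / (1 + 2 * s * v))) = √(2 * Real.pi * v) / √(1 + 2 * s * v : ℝ) := by
    rw [← Real.sqrt_div (by positivity), mul_div_assoc]
  rw [h1, mul_assoc, ← Real.exp_add, mul_mul_mul_comm, ← Real.exp_add]
  congr 1
  · have : √(1 + 2 * s * v : ℝ) ≠ 0 := (Real.sqrt_pos.2 ha).ne'
    field_simp
  · congr 1
    field_simp
    ring

theorem integral_mul_exp_neg_mul_sq_gaussianReal (m : ℝ) {v : NNReal} (hv : v ≠ 0) (s : NNReal)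
    (f : ℝ → ℝ) :
    ∫ x, f x * Real.exp (-(s * x ^ 2)) ∂gaussianReal m v
      = (∫ x, f x ∂gaussianReal (m / (1 + 2 * s * v)) (v / (1 + 2 * s * v)))
        * ((√(1 + 2 * s * v))⁻¹ * Real.exp (-(s * m ^ 2 / (1 + 2 * s * v)))) := by
  have hv2 : v / (1 + 2 * s * v) ≠ 0 := (div_pos (pos_iff_ne_zero.2 hv) (by positivity)).ne'
  rw [integral_gaussianReal_eq_integral_smul hv, integral_gaussianReal_eq_integral_smul hv2,
    ← integral_mul_const]
  congr 1
  funext x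
  have h := gaussianPDFReal_mul_exp_neg_mul_sq m hv s x
  simp only [smul_eq_mul]
  linear_combination f x * h

section

variable {ι : Type*} [Fintype ι] (μ : ι → ℝ) {v : NNReal}

theorem prod_inv_sqrt_mul_exp_eq_noncentralLaplace {s w : ℝ} (hw : 0 < w) (hs : 0 ≤ s) :
    ∏ i, ((√(1 + 2 * s * w))⁻¹ * Real.exp (-(s * μ i ^ 2 / (1 + 2 * s * w))))
      = noncentralLaplace (Fintype.card ι / 2) w (∑ i, μ i ^ 2) s := by
  have ha := one_add_two_mul_mul_pos hw hs
  rw [Finset.prod_mul_distrib, Finset.prod_const, Finset.card_univ, ← Real.exp_sum,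
    Finset.sum_neg_distrib, ← Finset.sum_div, ← Finset.mul_sum, noncentralLaplace]
  congr 1
  rw [Real.sqrt_eq_rpow, ← Real.rpow_neg ha.le, ← Real.rpow_natCast, ← Real.rpow_mul ha.le]
  congr 1
  ring

theorem integral_exp_neg_mul_sum_sq (hv : v ≠ 0) {s : ℝ} (hs : 0 ≤ s) :
    ∫ m, Real.exp (-(s * ∑ i, m i ^ 2)) ∂(Measure.pi fun i => gaussianReal (μ i) v)
      = noncentralLaplace (Fintype.card ι / 2) v (∑ i, μ i ^ 2) s := by
  lift s to NNReal using hs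
  have hv' : (0 : ℝ) < v := by exact_mod_cast pos_iff_ne_zero.2 hv
  simp_rw [Finset.mul_sum, ← Finset.sum_neg_distrib, Real.exp_sum]
  rw [integral_fintype_prod_eq_prod (fun _ x => Real.exp (-((s : ℝ) * x ^ 2))),
    ← prod_inv_sqrt_mul_exp_eq_noncentralLaplace μ hv' s.coe_nonneg]
  refine Finset.prod_congr rfl fun i _ => ?_
  simpa using integral_mul_exp_neg_mul_sq_gaussianReal (μ i) hv s fun _ => 1

theorem integral_apply_mul_exp_neg_mul_sum_sq (hv : v ≠ 0) {s : ℝ} (hs : 0 ≤ s) (j : ι) :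
    ∫ m, m j * Real.exp (-(s * ∑ i, m i ^ 2)) ∂(Measure.pi fun i => gaussianReal (μ i) v)
      = μ j / (1 + 2 * s * v) * noncentralLaplace (Fintype.card ι / 2) v (∑ i, μ i ^ 2) s := by
  classical
  lift s to NNReal using hs
  have hv' : (0 : ℝ) < v := by exact_mod_cast pos_iff_ne_zero.2 hv
  have hprod : ∀ m : ι → ℝ, m j * Real.exp (-(s * ∑ i, m i ^ 2))
      = ∏ i, ((if j = i then m i else 1) * Real.exp (-(s * m i ^ 2))) := fun m => by
    rw [Finset.prod_mul_distrib, Finset.prod_ite_eq, if_pos (Finset.mem_univ j), Finset.mul_sum,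
      ← Finset.sum_neg_distrib, Real.exp_sum]
  simp_rw [hprod]
  rw [integral_fintype_prod_eq_prod
      (fun i x => (if j = i then x else 1) * Real.exp (-((s : ℝ) * x ^ 2))),
    ← prod_inv_sqrt_mul_exp_eq_noncentralLaplace μ hv' s.coe_nonneg]
  have hint : ∀ i, ∫ x, (if j = i then x else 1) * Real.exp (-((s : ℝ) * x ^ 2))
        ∂gaussianReal (μ i) v
      = (if j = i then μ i / (1 + 2 * s * v) else 1)
        * ((√(1 + 2 * s * v))⁻¹ * Real.exp (-(s * μ i ^ 2 / (1 + 2 * s * v)))) := fun i => by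
    rw [integral_mul_exp_neg_mul_sq_gaussianReal (μ i) hv s fun x => if j = i then x else 1]
    split_ifs <;> simp [integral_id_gaussianReal]
  simp_rw [hint]
  rw [Finset.prod_mul_distrib, Finset.prod_ite_eq, if_pos (Finset.mem_univ j)]

theorem integrableOn_exp_neg_mul_Ioi {q : ℝ} (hq : 0 < q) :
    IntegrableOn (fun s : ℝ => Real.exp (-(s * q))) (Set.Ioi 0) := by
  simpa [mul_comm] using integrableOn_exp_mul_Ioi (neg_lt_zero.2 hq) 0

theorem integral_exp_neg_mul_Ioi {q : ℝ} (hq : 0 < q) :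
    ∫ s in Set.Ioi (0 : ℝ), Real.exp (-(s * q)) = q⁻¹ := by
  simpa [mul_comm, neg_div_neg_eq] using integral_exp_mul_Ioi (neg_lt_zero.2 hq) 0

theorem ae_sum_sq_pos [Nonempty ι] (hv : v ≠ 0) :
    ∀ᵐ m ∂(Measure.pi fun i => gaussianReal (μ i) v), 0 < ∑ i, m i ^ 2 := by
  have : ∀ i, NullSingletonClass (gaussianReal (μ i) v) :=
    fun i => nullSingletonClass_gaussianReal hv
  obtain ⟨i⟩ := ‹Nonempty ι›
  filter_upwards [Measure.ae_eval_ne (μ := fun i => gaussianReal (μ i) v) i 0] with m hm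
  exact Finset.sum_pos' (fun _ _ => sq_nonneg _) ⟨i, Finset.mem_univ i, by positivity⟩

theorem integrable_prod_exp_neg_mul_sum_sq (hv : v ≠ 0) (hι : 3 ≤ Fintype.card ι) :
    Integrable (fun z : (ι → ℝ) × ℝ => Real.exp (-(z.2 * ∑ i, z.1 i ^ 2)))
      ((Measure.pi fun i => gaussianReal (μ i) v).prod (volume.restrict (Set.Ioi 0))) := by
  have hv' : (0 : ℝ) < v := by exact_mod_cast pos_iff_ne_zero.2 hv
  have hp : (1 : ℝ) < Fintype.card ι / 2 := by
    have : (3 : ℝ) ≤ Fintype.card ι := by exact_mod_cast hι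
    linarith
  refine (integrable_prod_iff' (by fun_prop)).2 ⟨?_, ?_⟩
  · filter_upwards [ae_restrict_mem measurableSet_Ioi] with s hs
    refine Integrable.of_bound (Measurable.aestronglyMeasurable (by fun_prop)) 1 (Filter.Eventually.of_forall fun m => ?_)
    have hs : 0 < s := hs
    rw [Real.norm_of_nonneg (Real.exp_pos _).le, Real.exp_le_one_iff, neg_nonpos]
    positivity
  · refine (integrableOn_noncentralLaplace hp hv'
      (Finset.univ.sum_nonneg fun i _ => sq_nonneg (μ i))).congr ?_
    filter_upwards [ae_restrict_mem measurableSet_Ioi] with s hs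
    simp_rw [Real.norm_of_nonneg (Real.exp_pos _).le]
    exact (integral_exp_neg_mul_sum_sq μ hv (le_of_lt hs)).symm

theorem integrable_inv_sum_sq (hv : v ≠ 0) (hι : 3 ≤ Fintype.card ι) :
    Integrable (fun m : ι → ℝ => (∑ i, m i ^ 2)⁻¹)
      (Measure.pi fun i => gaussianReal (μ i) v) := by
  have : Nonempty ι := Fintype.card_pos_iff.1 (by lia)
  refine (integrable_prod_exp_neg_mul_sum_sq μ hv hι).integral_prod_left.congr ?_
  filter_upwards [ae_sum_sq_pos μ hv] with m hm using integral_exp_neg_mul_Ioi hm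

theorem integrable_apply_mul_inv_sum_sq (hv : v ≠ 0) (hι : 3 ≤ Fintype.card ι) (j : ι) :
    Integrable (fun m : ι → ℝ => m j * (∑ i, m i ^ 2)⁻¹)
      (Measure.pi fun i => gaussianReal (μ i) v) := by
  have : Nonempty ι := ⟨j⟩
  refine ((integrable_inv_sum_sq μ hv hι).add (integrable_const 1)).mono' (by fun_prop) ?_
  filter_upwards [ae_sum_sq_pos μ hv] with m hm
  rw [norm_mul, norm_inv, Real.norm_of_nonneg hm.le, Real.norm_eq_abs, Pi.add_apply,
    ← div_eq_mul_inv, div_le_iff₀ hm, add_mul, inv_mul_cancel₀ hm.ne', one_mul]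
  have hj : m j ^ 2 ≤ ∑ i, m i ^ 2 :=
    Finset.single_le_sum (f := fun i => m i ^ 2) (fun i _ => sq_nonneg _) (Finset.mem_univ j)
  nlinarith [sq_abs (m j), sq_nonneg (|m j| - 1)]

theorem integral_apply_mul_inv_sum_sq (hv : v ≠ 0) (hι : 3 ≤ Fintype.card ι) (j : ι) :
    ∫ m, m j * (∑ i, m i ^ 2)⁻¹ ∂(Measure.pi fun i => gaussianReal (μ i) v)
      = ∫ s in Set.Ioi (0 : ℝ), μ j / (1 + 2 * s * v)
          * noncentralLaplace (Fintype.card ι / 2) v (∑ i, μ i ^ 2) s := by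
  have : Nonempty ι := ⟨j⟩
  have hint : Integrable (Function.uncurry fun (m : ι → ℝ) (s : ℝ) =>
      m j * Real.exp (-(s * ∑ i, m i ^ 2)))
      ((Measure.pi fun i => gaussianReal (μ i) v).prod (volume.restrict (Set.Ioi 0))) := by
    refine (integrable_prod_iff (by unfold Function.uncurry; fun_prop)).2 ⟨?_, ?_⟩
    · filter_upwards [ae_sum_sq_pos μ hv] with m hm
      exact (integrableOn_exp_neg_mul_Ioi hm).const_mul (m j)
    · refine (integrable_apply_mul_inv_sum_sq μ hv hι j).norm.congr ?_
      filter_upwards [ae_sum_sq_pos μ hv] with m hm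
      simp only [Function.uncurry, norm_mul, Real.norm_of_nonneg (Real.exp_pos _).le]
      rw [integral_const_mul, integral_exp_neg_mul_Ioi hm, norm_inv, Real.norm_of_nonneg hm.le]
  calc
    _ = ∫ m, (∫ s in Set.Ioi (0 : ℝ), m j * Real.exp (-(s * ∑ i, m i ^ 2)))
          ∂(Measure.pi fun i => gaussianReal (μ i) v) := by
      refine integral_congr_ae ?_
      filter_upwards [ae_sum_sq_pos μ hv] with m hm
      rw [integral_const_mul, integral_exp_neg_mul_Ioi hm]
    _ = _ := by
      rw [integral_integral_swap hint]
      exact setIntegral_congr_fun measurableSet_Ioi fun s hs =>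
        integral_apply_mul_exp_neg_mul_sum_sq μ hv (le_of_lt hs) j

theorem integral_sum_sub_mul_div_sum_sq (hv : v ≠ 0) (hι : 3 ≤ Fintype.card ι) :
    ∫ m, (∑ i, (m i - μ i) * m i) / (∑ i, m i ^ 2) ∂(Measure.pi fun i => gaussianReal (μ i) v)
      = (Fintype.card ι - 2) * v
        * ∫ s in Set.Ioi (0 : ℝ), noncentralLaplace (Fintype.card ι / 2) v (∑ i, μ i ^ 2) s := by
  have : Nonempty ι := Fintype.card_pos_iff.1 (by lia)
  have hv' : (0 : ℝ) < v := by exact_mod_cast pos_iff_ne_zero.2 hv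
  have hp : (1 : ℝ) < Fintype.card ι / 2 := by
    have : (3 : ℝ) ≤ Fintype.card ι := by exact_mod_cast hι
    linarith
  have hS : 0 ≤ ∑ i, μ i ^ 2 := Finset.sum_nonneg fun i _ => sq_nonneg (μ i)
  have hint : ∀ i ∈ Finset.univ, Integrable (fun m : ι → ℝ => μ i * (m i * (∑ i, m i ^ 2)⁻¹))
      (Measure.pi fun i => gaussianReal (μ i) v) :=
    fun i _ => (integrable_apply_mul_inv_sum_sq μ hv hι i).const_mul (μ i)
  calc
    _ = ∫ m, (1 - ∑ i, μ i * (m i * (∑ i, m i ^ 2)⁻¹))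
          ∂(Measure.pi fun i => gaussianReal (μ i) v) := by
      refine integral_congr_ae ?_
      filter_upwards [ae_sum_sq_pos μ hv] with m hm
      simp_rw [sub_mul, Finset.sum_sub_distrib, ← mul_assoc, ← Finset.sum_mul, ← sq]
      rw [sub_div, div_self hm.ne', div_eq_mul_inv]
    _ = 1 - ∫ s in Set.Ioi (0 : ℝ), (∑ i, μ i ^ 2) / (1 + 2 * s * v)
          * noncentralLaplace (Fintype.card ι / 2) v (∑ i, μ i ^ 2) s := by
      rw [integral_sub (integrable_const 1) (integrable_finsetSum _ hint),
        integral_finsetSum _ hint, integral_const, probReal_univ, one_smul]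
      simp_rw [integral_const_mul, integral_apply_mul_inv_sum_sq μ hv hι, ← integral_const_mul]
      rw [← integral_finsetSum _ fun i _ =>
        (integrableOn_div_mul_noncentralLaplace hp hv' hS (μ i)).const_mul (μ i)]
      congr 2
      funext s
      rw [Finset.sum_div, Finset.sum_mul]
      exact Finset.sum_congr rfl fun i _ => by ring
    _ = _ := by
      rw [integral_div_mul_noncentralLaplace hp hv' hS]
      ring

end

/-- Let `ℓ ≥ 3`, `μ ∈ ℝ^ℓ`, `τ > 0`, and `M` a random vector in `ℝ^ℓ`
with independent coordinates `M_i ~ N(μ_i, τ²)`. With `κ = ‖μ‖²/(2τ²)`, one has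
`E[(M − μ)'M/‖M‖²] = ∑_{k} ((ℓ−2)/(ℓ−2+2k)) κ^k e^{−κ}/k!`
(the expectation of `(ℓ−2)/(ℓ−2+2K)` for `K` Poisson with mean `κ`). -/
theorem gaussian_residual_projection_moment (ℓ : ℕ) (hℓ : 3 ≤ ℓ)
    (μ : Fin ℓ → ℝ) (τ : ℝ) (hτ : 0 < τ)
    (κ : ℝ) (hκ : κ = (∑ i, μ i ^ 2) / (2 * τ ^ 2)) :
    (∫ m, (∑ i, (m i - μ i) * m i) / (∑ i, m i ^ 2) ∂(gaussianVecLaw ℓ μ τ))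
      = ∑' k : ℕ, (((ℓ : ℝ) - 2) / ((ℓ : ℝ) - 2 + 2 * k))
          * (κ ^ k * Real.exp (-κ) / (Nat.factorial k)) := by
  have hv : (τ ^ 2).toNNReal ≠ 0 := by simpa using hτ.ne'
  have hvr : ((τ ^ 2).toNNReal : ℝ) = τ ^ 2 := Real.coe_toNNReal _ (sq_nonneg τ)
  have hℓ' : (3 : ℝ) ≤ ℓ := by exact_mod_cast hℓ
  have h := integral_sum_sub_mul_div_sum_sq μ hv (by simpa using hℓ)
  rw [hvr, Fintype.card_fin] at h
  rw [gaussianVecLaw, h, integral_noncentralLaplace_eq_tsum (by linarith) (by positivity)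
    (Finset.sum_nonneg fun i _ => sq_nonneg (μ i)), ← hκ, ← tsum_mul_left]
  refine tsum_congr fun k => ?_
  rw [← mul_assoc]
  congr 1
  have hk : (ℓ : ℝ) - 2 + 2 * k ≠ 0 := by
    have := k.cast_nonneg (α := ℝ)
    linarith
  rw [show 2 * τ ^ 2 * ((ℓ : ℝ) / 2 + k - 1) = τ ^ 2 * (ℓ - 2 + 2 * k) by ring]
  field_simp
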